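/- Let f, g : 𝔸^× → ℂ be defined by f(x) = a_n e^{-2π|x_∞|} if the finite part x_f lies in n·Ẑ^× (n a positive integer), f(x) = 0 if x_f is not integral, and g(x) = b_n e^{-2π|x_∞|} if x_f ∈ n·Ẑ^×, g(x) = 0 if x_f is not integral. Let s₁, s₂ be complex numbers with Re(s₁) > k and Re(s₂) > l. Then ∫∫_{{(x₁,x₂) : |x₁| > |x₂|}} f(x₁)|x₁|^{s₁} g(x₂)|x₂|^{s₂} dμ(x₁) dμ(x₂) = 4 ∫∫_{{t₁ > t₂ > 0}} F(it₁) G(it₂) t₁^{s₁-1} t₂^{s₂-1} dt₁ dt₂, i.e. the adelic iterated integral equals (up to the factor 4 coming from the two signs at the real place) the completed iterated L-function Λ(F,G,s₁,s₂) of Manin, given by the iterated integral of F and G over the geodesic joining 0 and i∞. -/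

import Mathlib

open MeasureTheory

noncomputable section

instance (p : Nat.Primes) : Fact (p : ℕ).Prime := ⟨p.2⟩

/-- The group in which finite ideles live: tuples of nonzero `p`-adic numbers. -/
abbrev IdeleComponents : Type := ∀ p : Nat.Primes, ℚ_[(p : ℕ)]ˣ

/-- The group of finite ideles of `ℚ`: tuples of nonzero `p`-adic numbers which are
`p`-adic units for all but finitely many `p` (the unit group of the restricted
product of the `ℚ_p` with respect to the `ℤ_p`). -/
def FiniteIdeles : Subgroup IdeleComponents where
  carrier := {x | {p : Nat.Primes | ‖((x p : ℚ_[(p : ℕ)]))‖ ≠ 1}.Finite}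
  one_mem' := by
    simp
  mul_mem' := by
    intro x y hx hy
    refine (hx.union hy).subset ?_
    intro p hp
    by_contra h
    simp only [Set.mem_union, Set.mem_setOf_eq, not_or, not_not] at h
    apply hp
    simp [Pi.mul_apply, Units.val_mul, norm_mul, h.1, h.2]
  inv_mem' := by
    intro x hx
    refine hx.subset ?_
    intro p hp
    simp only [Set.mem_setOf_eq, Pi.inv_apply] at hp ⊢
    rw [Units.val_inv_eq_inv_val, norm_inv] at hp
    intro h
    rw [h] at hp
    simp at hp

/-- The idele norm of a finite idele: the product `∏_p |x_p|_p` over all primes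
(all but finitely many factors equal `1`). -/
def fnorm (x : FiniteIdeles) : ℝ :=
  ∏ᶠ p : Nat.Primes, ‖((x : IdeleComponents) p : ℚ_[(p : ℕ)])‖

/-- A finite idele is integral if all of its components are `p`-adic integers. -/
def IsIntegralIdele (x : FiniteIdeles) : Prop :=
  ∀ p : Nat.Primes, ‖((x : IdeleComponents) p : ℚ_[(p : ℕ)])‖ ≤ 1

/-- The subset `Ẑ^×` of the finite ideles: all components are `p`-adic units. -/
def zHatUnits : Set FiniteIdeles :=
  {x | ∀ p : Nat.Primes, ‖((x : IdeleComponents) p : ℚ_[(p : ℕ)])‖ = 1}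


/-- The idele group of `ℚ`, presented as `ℝˣ × 𝔸_f^×`. -/
abbrev Ideles : Type := ℝˣ × FiniteIdeles

/-- The idele norm `|x| = |x_∞|_∞ · ∏_p |x_p|_p`. -/
def inorm (x : Ideles) : ℝ := |(x.1 : ℝ)| * fnorm x.2

/-- The restriction of a function on the upper half plane to the geodesic from `0`
to `i∞`, i.e. `t ↦ F(it)` for `t > 0` (junk value `0` otherwise). -/
def onImAxis (F : UpperHalfPlane → ℂ) (t : ℝ) : ℂ :=
  if ht : 0 < t then F ⟨Complex.I * t, by simpa using ht⟩ else 0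

/-- Either the `q`-series diverges everywhere on the imaginary axis, or its coefficients satisfy the
Hecke bound. -/
theorem cuspForm_coeff_dichotomy {k : ℤ} (F : CuspForm (CongruenceSubgroup.Gamma 1) k)
    (a : ℕ+ → ℂ)
    (hFa : ∀ z : UpperHalfPlane, F z =
      ∑' n : ℕ+, a n * Complex.exp (2 * Real.pi * Complex.I * (n : ℕ) * (z : ℂ))) :
    (∀ y : ℝ, 0 < y → ¬ Summable fun n : ℕ+ ↦ a n * Complex.exp (-(2 * Real.pi * n * y))) ∨
      ∃ C, ∀ n : ℕ+, ‖a n‖ ≤ C * ((n : ℕ) : ℝ) ^ ((k : ℝ) / 2) := by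
  rw [or_iff_not_imp_left]
  intro h
  push Not at h
  obtain ⟨y, hy, hsum⟩ := h
  have hper : (1 : ℝ) ∈ (CongruenceSubgroup.Gamma 1 : Subgroup (GL (Fin 2) ℝ)).strictPeriods := by
    simp
  have hwidth : (CongruenceSubgroup.Gamma 1 : Subgroup (GL (Fin 2) ℝ)).strictWidthInfty = 1 := by
    simp
  let c : ℕ → ℂ := fun n ↦ if hn : 0 < n then a ⟨n, hn⟩ else 0
  have hc : ∀ n : ℕ+, c n = a n := fun n ↦ by
    simp only [c, n.pos, dif_pos]; rfl
  have hc0 : c 0 = 0 := by simp [c]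
  let r : NNReal := ⟨Real.exp (-(2 * Real.pi * y)), (Real.exp_pos _).le⟩
  have hr : (r : ℝ) = Real.exp (-(2 * Real.pi * y)) := rfl
  have hr0 : 0 < r := Real.exp_pos _
  have hr1 : (r : ℝ) < 1 := by
    rw [hr, Real.exp_lt_one_iff]
    have := Real.pi_pos
    have : 0 < 2 * Real.pi * y := by positivity
    linarith
  have hcr : Summable fun n : ℕ ↦ ‖c n‖ * (r : ℝ) ^ n := by
    rw [← summable_pnat_iff_summable_nat]
    refine hsum.norm.congr fun n ↦ ?_
    rw [hc, norm_mul, Complex.norm_exp, hr, ← Real.exp_nat_mul]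
    congr 2
    rw [show (-(2 * Real.pi * n * y) : ℂ) = ((-(2 * Real.pi * n * y) : ℝ) : ℂ) by push_cast; ring,
      Complex.ofReal_re]
    ring
  have hq : ∀ q : ℂ, ‖q‖ < r → q ≠ 0 →
      HasSum (fun n : ℕ ↦ c n * q ^ n) (UpperHalfPlane.cuspFunction 1 F q) := by
    intro q hqr hq0
    have him := Function.Periodic.im_invQParam_pos_of_norm_lt_one one_pos (hqr.trans hr1) hq0
    have hinv := Function.Periodic.qParam_right_inv one_ne_zero hq0
    have hF := hFa ⟨_, him⟩
    have hcF := SlashInvariantFormClass.eq_cuspFunction F ⟨_, him⟩ hper one_ne_zero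
    simp only at hcF
    rw [hinv] at hcF
    have hpow : ∀ n : ℕ, Complex.exp (2 * Real.pi * Complex.I * n *
        (Function.Periodic.invQParam 1 q)) = q ^ n := by
      intro n
      conv_rhs => rw [← hinv]
      rw [Function.Periodic.qParam, ← Complex.exp_nat_mul]
      congr 1
      push_cast
      ring
    have hs : Summable fun n : ℕ ↦ c n * q ^ n := by
      refine Summable.of_norm_bounded hcr fun n ↦ ?_
      rw [norm_mul, norm_pow]
      gcongr
    rw [hcF, hF]
    simp only [hpow, ← hc]
    rw [tsum_pnat_eq_tsum_of_eq_zero (f := fun n : ℕ ↦ c n * q ^ n) (by simp [hc0])]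
    exact hs.hasSum
  have h1 : HasFPowerSeriesOnBall (UpperHalfPlane.cuspFunction 1 F)
      (FormalMultilinearSeries.ofScalars ℂ c) 0 r := by
    refine ⟨?_, by simpa using hr0, ?_⟩
    · apply FormalMultilinearSeries.le_radius_of_summable
      simpa using hcr
    · intro q hqr
      rw [Metric.eball_coe, mem_ball_zero_iff] at hqr
      rcases eq_or_ne q 0 with rfl | hq0
      · rw [add_zero, CuspFormClass.cuspFunction_apply_zero F one_pos hper]
        convert! hasSum_zero with n
        rcases n with _ | n <;> simp [hc0]
      · simpa [mul_comm] using hq q hqr hq0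
  have : Fact (IsCusp OnePoint.infty (CongruenceSubgroup.Gamma 1 : Subgroup (GL (Fin 2) ℝ))) :=
    ⟨Subgroup.isCusp_of_mem_strictPeriods one_pos hper⟩
  have h2 := UpperHalfPlane.hasFPowerSeries_cuspFunction F one_pos
    (ModularFormClass.analyticAt_cuspFunction_zero F one_pos hper)
    (fun τ ↦ UpperHalfPlane.hasSum_qExpansion one_pos
      (SlashInvariantFormClass.periodic_comp_ofComplex F hper) (ModularFormClass.holo F)
      (ModularFormClass.bdd_at_infty F) τ)
  have hcoeff : ∀ n, c n = (UpperHalfPlane.qExpansion 1 F).coeff n := fun n ↦ by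
    simpa using congr_arg (FormalMultilinearSeries.coeff · n)
      (h1.hasFPowerSeriesAt.eq_formalMultilinearSeries h2.hasFPowerSeriesAt)
  have hO := CuspFormClass.qExpansion_isBigO F
  rw [hwidth] at hO
  obtain ⟨C, -, hC⟩ := Asymptotics.bound_of_isBigO_nat_atTop hO
  refine ⟨C, fun n ↦ ?_⟩
  have hn : 0 < ((n : ℕ) : ℝ) ^ ((k : ℝ) / 2) := Real.rpow_pos_of_pos (by exact_mod_cast n.pos) _
  rw [← hc, hcoeff]
  exact (hC hn.ne').trans_eq (by rw [Real.norm_of_nonneg hn.le])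

instance : MeasurableSpace ℕ+ := ⊤

instance : DiscreteMeasurableSpace ℕ+ := ⟨fun _ ↦ trivial⟩

/-- The Haar measure `dt / t` of the multiplicative group of positive reals, as a measure on `ℝ`. -/
def positiveHaar : Measure ℝ :=
  (volume.restrict (Set.Ioi 0)).withDensity fun t ↦ ENNReal.ofReal t⁻¹

instance : SigmaFinite positiveHaar := by
  unfold positiveHaar
  infer_instance

theorem ae_positiveHaar_iff {p : ℝ → Prop} :
    (∀ᵐ t ∂positiveHaar, p t) ↔ ∀ᵐ t : ℝ, 0 < t → p t := by
  rw [positiveHaar, ae_withDensity_iff (by fun_prop), ae_restrict_iff' measurableSet_Ioi]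
  refine Filter.eventually_congr (.of_forall fun t ↦ ?_)
  simp +contextual

theorem exists_mem_Ioo_of_ae_positiveHaar {p : ℝ → Prop} (hp : ∀ᵐ t ∂positiveHaar, p t)
    {x y : ℝ} (hx : 0 ≤ x) (hxy : x < y) : ∃ t ∈ Set.Ioo x y, p t := by
  rw [ae_positiveHaar_iff] at hp
  by_contra! h
  have h0 : volume (Set.Ioo x y) = 0 :=
    measure_mono_null (fun t ht ↦ by simpa using ⟨hx.trans_lt ht.1, h t ht⟩) (ae_iff.mp hp)
  simp [hxy.not_ge] at h0

theorem integrable_positiveHaar_iff {f : ℝ → ℝ} :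
    Integrable f positiveHaar ↔ IntegrableOn (fun t ↦ t⁻¹ * f t) (Set.Ioi 0) := by
  rw [positiveHaar, integrable_withDensity_iff_integrable_smul' (by fun_prop) (by simp)]
  refine integrable_congr ?_
  filter_upwards [self_mem_ae_restrict measurableSet_Ioi] with t ht
  rw [ENNReal.toReal_ofReal (inv_nonneg.mpr (le_of_lt ht))]
  simp

theorem integral_positiveHaar (f : ℝ → ℝ) :
    ∫ t, f t ∂positiveHaar = ∫ t in Set.Ioi 0, t⁻¹ * f t := by
  rw [positiveHaar, integral_withDensity_eq_integral_toReal_smul (by fun_prop) (by simp)]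
  refine integral_congr_ae ?_
  filter_upwards [self_mem_ae_restrict measurableSet_Ioi] with t ht
  rw [ENNReal.toReal_ofReal (inv_nonneg.mpr (le_of_lt ht)), smul_eq_mul]

/-- The `n`-th term `a_n e^{-2πnt} t^s` of the Mellin integrand of a `q`-series on the imaginary
axis. -/
def mellinTerm (a : ℕ+ → ℂ) (s : ℂ) (p : ℕ+ × ℝ) : ℂ :=
  a p.1 * Real.exp (-(2 * Real.pi * (p.1 * p.2))) * (p.2 : ℂ) ^ s

theorem measurable_mellinTerm (a : ℕ+ → ℂ) (s : ℂ) : Measurable (mellinTerm a s) := by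
  unfold mellinTerm
  have h1 : Measurable a := measurable_of_countable a
  have h2 : Measurable fun n : ℕ+ ↦ (n : ℝ) := measurable_of_countable _
  fun_prop

theorem integrable_mellinTerm {a : ℕ+ → ℂ} {s : ℂ} {C e : ℝ}
    (ha : ∀ n : ℕ+, ‖a n‖ ≤ C * ((n : ℕ) : ℝ) ^ e) (he0 : 0 ≤ e) (he : e + 1 < s.re) :
    Integrable (mellinTerm a s) ((Measure.count : Measure ℕ+).prod positiveHaar) := by
  have hs : 0 < s.re := by linarith
  have hnorm : ∀ (n : ℕ+), Set.EqOn (fun t : ℝ ↦ t⁻¹ * ‖mellinTerm a s (n, t)‖)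
      (fun t ↦ ‖a n‖ * (t ^ (s.re - 1) * Real.exp (-(2 * Real.pi * n * t)))) (Set.Ioi 0) := by
    intro n t ht
    have ht' : 0 < t := ht
    simp only [mellinTerm, norm_mul, Complex.norm_cpow_eq_rpow_re_of_pos ht', Complex.norm_real,
      Real.norm_of_nonneg (Real.exp_pos _).le, Real.rpow_sub_one ht'.ne']
    field_simp
  have hpi : ∀ n : ℕ+, 0 < 2 * Real.pi * n := fun n ↦ by
    have := Real.pi_pos
    have : (0 : ℝ) < n := by exact_mod_cast n.pos
    positivity
  rw [integrable_prod_iff (measurable_mellinTerm a s).aestronglyMeasurable]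
  constructor
  · refine .of_forall fun n ↦ ?_
    have hm : Measurable fun t ↦ mellinTerm a s (n, t) :=
      (measurable_mellinTerm a s).comp (by fun_prop)
    rw [← integrable_norm_iff hm.aestronglyMeasurable, integrable_positiveHaar_iff,
      integrableOn_congr_fun (hnorm n) measurableSet_Ioi]
    refine Integrable.const_mul ?_ _
    simpa [IntegrableOn] using integrableOn_rpow_mul_exp_neg_mul_rpow (p := 1) (s := s.re - 1)
      (by linarith) one_pos (hpi n)
  · rw [integrable_count_iff]
    refine Summable.of_norm_bounded (g := fun n : ℕ+ ↦ C * (((2 * Real.pi) ^ s.re)⁻¹ *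
      Real.Gamma s.re) * ((n : ℕ) : ℝ) ^ (e - s.re)) ?_ fun n ↦ ?_
    · refine Summable.mul_left _ ?_
      exact (Real.summable_nat_rpow.mpr (by linarith)).comp_injective PNat.coe_injective
    · have hn : (0 : ℝ) < ((n : ℕ) : ℝ) := by exact_mod_cast n.pos
      have hG := Real.Gamma_pos_of_pos hs
      have h2 : (0 : ℝ) < 2 * Real.pi := Real.two_pi_pos
      rw [integral_positiveHaar, setIntegral_congr_fun measurableSet_Ioi (hnorm n),
        integral_const_mul, Real.integral_rpow_mul_exp_neg_mul_Ioi hs (hpi n), norm_norm, norm_mul,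
        norm_norm, Real.norm_of_nonneg (by positivity), one_div, Real.inv_rpow (hpi n).le,
        Real.mul_rpow h2.le hn.le]
      refine (mul_le_mul_of_nonneg_right (ha n) (by positivity)).trans_eq ?_
      rw [Real.rpow_sub hn]
      field_simp

theorem integral_count_eq_tsum (f : ℕ+ → ℂ) : ∫ n, f n ∂Measure.count = ∑' n, f n := by
  by_cases hf : Summable f
  · rw [integral_countable (integrable_count_iff.mpr hf.norm)]
    simp
  · rw [tsum_eq_zero_of_not_summable hf, integral_undef]
    rwa [integrable_count_iff, summable_norm_iff]

theorem measurableSet_snd_lt_snd :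
    MeasurableSet {q : (ℕ+ × ℝ) × (ℕ+ × ℝ) | q.2.2 < q.1.2} :=
  measurableSet_lt (by fun_prop) (by fun_prop)

theorem setIntegral_mul_eq_of_integrable {A B : ℕ+ × ℝ → ℂ}
    (hA : Integrable A ((Measure.count : Measure ℕ+).prod positiveHaar))
    (hB : Integrable B ((Measure.count : Measure ℕ+).prod positiveHaar)) :
    ∫ q in {q : (ℕ+ × ℝ) × (ℕ+ × ℝ) | q.2.2 < q.1.2}, A q.1 * B q.2
      ∂(((Measure.count : Measure ℕ+).prod positiveHaar).prod
        ((Measure.count : Measure ℕ+).prod positiveHaar)) =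
    ∫ q in {q : ℝ × ℝ | q.2 < q.1}, (∑' n, A (n, q.1)) * (∑' m, B (m, q.2))
      ∂(positiveHaar.prod positiveHaar) := by
  have hA' : Integrable (fun t ↦ ∑' n, A (n, t)) positiveHaar := by
    simpa only [integral_count_eq_tsum] using hA.integral_prod_right
  have hB' : Integrable (fun t ↦ ∑' n, B (n, t)) positiveHaar := by
    simpa only [integral_count_eq_tsum] using hB.integral_prod_right
  have hlt : MeasurableSet {q : ℝ × ℝ | q.2 < q.1} :=
    measurableSet_lt measurable_snd measurable_fst
  have inner : ∀ t, ∫ q, Set.indicator {q : ℕ+ × ℝ | q.2 < t} B q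
      ∂((Measure.count : Measure ℕ+).prod positiveHaar) =
      ∫ u, Set.indicator {u | u < t} (fun u ↦ ∑' m, B (m, u)) u ∂positiveHaar := by
    intro t
    rw [integral_prod_symm _ (hB.indicator (measurableSet_lt measurable_snd measurable_const))]
    refine integral_congr_ae (.of_forall fun u ↦ ?_)
    simp only [integral_count_eq_tsum]
    by_cases h : u < t <;> simp [Set.indicator, h]
  rw [← integral_indicator measurableSet_snd_lt_snd, ← integral_indicator hlt,
    integral_prod _ ((hA.mul_prod hB).indicator measurableSet_snd_lt_snd),
    integral_prod _ ((hA'.mul_prod hB').indicator hlt)]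
  have e1 : ∀ p : ℕ+ × ℝ, ∫ q, Set.indicator {q : (ℕ+ × ℝ) × (ℕ+ × ℝ) | q.2.2 < q.1.2}
      (fun q ↦ A q.1 * B q.2) (p, q) ∂((Measure.count : Measure ℕ+).prod positiveHaar) =
      A p * ∫ u, Set.indicator {u | u < p.2} (fun u ↦ ∑' m, B (m, u)) u ∂positiveHaar := by
    intro p
    rw [← inner, ← integral_const_mul]
    refine integral_congr_ae (.of_forall fun q ↦ ?_)
    simp [Set.indicator]
  have e2 : ∀ t : ℝ, ∫ u, Set.indicator {q : ℝ × ℝ | q.2 < q.1}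
      (fun q ↦ (∑' n, A (n, q.1)) * (∑' m, B (m, q.2))) (t, u) ∂positiveHaar =
      (∑' n, A (n, t)) * ∫ u, Set.indicator {u | u < t} (fun u ↦ ∑' m, B (m, u)) u
        ∂positiveHaar := by
    intro t
    rw [← integral_const_mul]
    refine integral_congr_ae (.of_forall fun q ↦ ?_)
    simp [Set.indicator]
  have hint := ((hA.mul_prod hB).indicator measurableSet_snd_lt_snd).integral_prod_left
  simp only [e1, e2] at hint ⊢
  rw [integral_prod_symm _ hint]
  refine integral_congr_ae (.of_forall fun t ↦ ?_)
  simp only [integral_mul_const, integral_count_eq_tsum]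

theorem eq_zero_of_integrable_of_not_summable {A : ℕ+ × ℝ → ℂ}
    (hA : ∀ t, 0 < t → ¬ Summable fun n ↦ A (n, t)) {c : ℂ} {T : Set ℝ} {x y : ℝ} (hx : 0 ≤ x)
    (hxy : x < y) (hT : Set.Ioo x y ⊆ T) {f : ℕ+ × ℝ → ℂ} (hf : ∀ p, p.2 ∈ T → f p = A p * c)
    (hint : Integrable f ((Measure.count : Measure ℕ+).prod positiveHaar)) : c = 0 := by
  by_contra hc
  obtain ⟨t, ht, hsum⟩ := exists_mem_Ioo_of_ae_positiveHaar hint.prod_left_ae hx hxy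
  rw [integrable_count_iff, summable_norm_iff] at hsum
  refine hA t (hx.trans_lt ht.1) ?_
  refine (summable_mul_right_iff hc).mp (hsum.congr fun n ↦ ?_)
  rw [hf _ (hT ht)]

theorem ae_snd_pos : ∀ᵐ p ∂((Measure.count : Measure ℕ+).prod positiveHaar), 0 < p.2 :=
  Measure.quasiMeasurePreserving_snd.ae (ae_positiveHaar_iff.mpr (.of_forall fun _ ↦ id))

theorem setIntegral_mul_eq_zero_of_not_summable_left {A B : ℕ+ × ℝ → ℂ}
    (hA : ∀ t, 0 < t → ¬ Summable fun n ↦ A (n, t)) :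
    ∫ q in {q : (ℕ+ × ℝ) × (ℕ+ × ℝ) | q.2.2 < q.1.2}, A q.1 * B q.2
      ∂(((Measure.count : Measure ℕ+).prod positiveHaar).prod
        ((Measure.count : Measure ℕ+).prod positiveHaar)) = 0 := by
  rw [← integral_indicator measurableSet_snd_lt_snd]
  by_cases hint : Integrable (Set.indicator {q : (ℕ+ × ℝ) × (ℕ+ × ℝ) | q.2.2 < q.1.2}
      fun q ↦ A q.1 * B q.2) (((Measure.count : Measure ℕ+).prod positiveHaar).prod
        ((Measure.count : Measure ℕ+).prod positiveHaar))
  · rw [integral_prod_symm _ hint]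
    refine integral_eq_zero_of_ae ?_
    filter_upwards [hint.prod_left_ae, ae_snd_pos] with p hp hp0
    have hB : B p = 0 := eq_zero_of_integrable_of_not_summable hA hp0.le (lt_add_one p.2)
      (T := Set.Ioi p.2) Set.Ioo_subset_Ioi_self
      (fun q hq ↦ by simp [Set.indicator, Set.mem_Ioi.mp hq]) hp
    simp [Set.indicator, hB]
  · exact integral_undef hint

theorem setIntegral_mul_eq_zero_of_not_summable_right {A B : ℕ+ × ℝ → ℂ}
    (hB : ∀ t, 0 < t → ¬ Summable fun n ↦ B (n, t)) :
    ∫ q in {q : (ℕ+ × ℝ) × (ℕ+ × ℝ) | q.2.2 < q.1.2}, A q.1 * B q.2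
      ∂(((Measure.count : Measure ℕ+).prod positiveHaar).prod
        ((Measure.count : Measure ℕ+).prod positiveHaar)) = 0 := by
  rw [← integral_indicator measurableSet_snd_lt_snd]
  by_cases hint : Integrable (Set.indicator {q : (ℕ+ × ℝ) × (ℕ+ × ℝ) | q.2.2 < q.1.2}
      fun q ↦ A q.1 * B q.2) (((Measure.count : Measure ℕ+).prod positiveHaar).prod
        ((Measure.count : Measure ℕ+).prod positiveHaar))
  · rw [integral_prod _ hint]
    refine integral_eq_zero_of_ae ?_
    filter_upwards [hint.prod_right_ae, ae_snd_pos] with p hp hp0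
    have hA : A p = 0 := eq_zero_of_integrable_of_not_summable hB le_rfl hp0
      (T := Set.Iio p.2) Set.Ioo_subset_Iio_self
      (fun q hq ↦ by simp [Set.indicator, Set.mem_Iio.mp hq, mul_comm]) hp
    simp [Set.indicator, hA]
  · exact integral_undef hint

/-- Iterated Mellin integrals of a product of two `q`-series on the imaginary axis. When a series
diverges everywhere, both sides vanish. -/
theorem setIntegral_mellinTerm {a b : ℕ+ → ℂ} {s₁ s₂ : ℂ} {e₁ e₂ : ℝ}
    (ha : (∀ y : ℝ, 0 < y → ¬ Summable fun n : ℕ+ ↦ a n * Complex.exp (-(2 * Real.pi * n * y))) ∨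
      ∃ C, ∀ n : ℕ+, ‖a n‖ ≤ C * ((n : ℕ) : ℝ) ^ e₁) (he₁ : 0 ≤ e₁) (hs₁ : e₁ + 1 < s₁.re)
    (hb : (∀ y : ℝ, 0 < y → ¬ Summable fun n : ℕ+ ↦ b n * Complex.exp (-(2 * Real.pi * n * y))) ∨
      ∃ C, ∀ n : ℕ+, ‖b n‖ ≤ C * ((n : ℕ) : ℝ) ^ e₂) (he₂ : 0 ≤ e₂) (hs₂ : e₂ + 1 < s₂.re) :
    ∫ q in {q : (ℕ+ × ℝ) × (ℕ+ × ℝ) | q.2.2 < q.1.2}, mellinTerm a s₁ q.1 * mellinTerm b s₂ q.2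
      ∂(((Measure.count : Measure ℕ+).prod positiveHaar).prod
        ((Measure.count : Measure ℕ+).prod positiveHaar)) =
    ∫ q in {q : ℝ × ℝ | q.2 < q.1}, (∑' n, mellinTerm a s₁ (n, q.1)) *
      (∑' m, mellinTerm b s₂ (m, q.2)) ∂(positiveHaar.prod positiveHaar) := by
  have key : ∀ {a : ℕ+ → ℂ} {s : ℂ}, (∀ y : ℝ, 0 < y →
      ¬ Summable fun n : ℕ+ ↦ a n * Complex.exp (-(2 * Real.pi * n * y))) →
      ∀ t, 0 < t → ¬ Summable fun n ↦ mellinTerm a s (n, t) := by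
    intro a s h t ht hsum
    have hts : (t : ℂ) ^ s ≠ 0 := by
      rw [Complex.cpow_ne_zero_iff]
      exact .inl (by exact_mod_cast ht.ne')
    refine h t ht ((summable_mul_right_iff hts).mp (hsum.congr fun n ↦ ?_))
    simp [mellinTerm, mul_assoc]
  have zero : ∀ {f : ℝ × ℝ → ℂ} (S : Set (ℝ × ℝ)), (∀ q : ℝ × ℝ, 0 < q.1 → 0 < q.2 → f q = 0) →
      ∫ q in S, f q ∂(positiveHaar.prod positiveHaar) = 0 := by
    intro f S hf
    have hpos : ∀ᵐ t ∂positiveHaar, 0 < t := ae_positiveHaar_iff.mpr (.of_forall fun _ ↦ id)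
    refine integral_eq_zero_of_ae (ae_restrict_of_ae ?_)
    filter_upwards [Measure.quasiMeasurePreserving_fst.ae hpos,
      Measure.quasiMeasurePreserving_snd.ae hpos] with q h1 h2 using hf q h1 h2
  rcases ha with ha | ⟨C, hC⟩
  · rw [setIntegral_mul_eq_zero_of_not_summable_left (key ha), zero]
    intro q h1 h2
    rw [tsum_eq_zero_of_not_summable (key ha _ h1), zero_mul]
  rcases hb with hb | ⟨D, hD⟩
  · rw [setIntegral_mul_eq_zero_of_not_summable_right (key hb), zero]
    intro q h1 h2
    rw [tsum_eq_zero_of_not_summable (key hb _ h2), mul_zero]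
  exact setIntegral_mul_eq_of_integrable (integrable_mellinTerm hC he₁ hs₁)
    (integrable_mellinTerm hD he₂ hs₂)

theorem setIntegral_positiveHaar_prod (f : ℝ × ℝ → ℂ) :
    ∫ q in {q : ℝ × ℝ | q.2 < q.1}, f q ∂(positiveHaar.prod positiveHaar) =
      ∫ q in {q : ℝ × ℝ | q.2 < q.1 ∧ 0 < q.2}, (q.1 : ℂ)⁻¹ * (q.2 : ℂ)⁻¹ * f q := by
  have hlt : MeasurableSet {q : ℝ × ℝ | q.2 < q.1} :=
    measurableSet_lt measurable_snd measurable_fst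
  have hset : {q : ℝ × ℝ | q.2 < q.1} ∩ Set.Ioi 0 ×ˢ Set.Ioi 0 = {q | q.2 < q.1 ∧ 0 < q.2} := by
    ext q
    simp only [Set.mem_inter_iff, Set.mem_ofPred_eq, Set.mem_prod, Set.mem_Ioi]
    grind
  have hm : MeasurableSet {q : ℝ × ℝ | q.2 < q.1 ∧ 0 < q.2} :=
    hset ▸ hlt.inter (measurableSet_Ioi.prod measurableSet_Ioi)
  rw [positiveHaar, prod_withDensity (by fun_prop) (by fun_prop), Measure.prod_restrict,
    restrict_withDensity hlt, Measure.restrict_restrict hlt, hset,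
    integral_withDensity_eq_integral_toReal_smul (by fun_prop) (by simp [ENNReal.mul_lt_top]),
    ← Measure.volume_eq_prod]
  refine setIntegral_congr_fun hm fun q hq ↦ ?_
  have h2 : 0 < q.2 := hq.2
  have h1 : 0 < q.1 := h2.trans hq.1
  simp [h1.le, h2.le]

theorem norm_natCast_prime (p q : Nat.Primes) :
    ‖(((q : ℕ) : ℕ) : ℚ_[(p : ℕ)])‖ = if p = q then ((q : ℕ) : ℝ)⁻¹ else 1 := by
  split_ifs with h
  · subst h
    exact Padic.norm_p
  · rw [Padic.norm_natCast_eq_one_iff, Nat.coprime_primes p.2 q.2]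
    exact fun h' ↦ h (Subtype.ext h')

theorem finprod_norm_natCast {n : ℕ} (hn : n ≠ 0) :
    (Function.mulSupport fun p : Nat.Primes ↦ ‖(n : ℚ_[(p : ℕ)])‖).Finite ∧
      ∏ᶠ p : Nat.Primes, ‖(n : ℚ_[(p : ℕ)])‖ = (n : ℝ)⁻¹ := by
  induction n using induction_on_primes with
  | zero => exact absurd rfl hn
  | one => simp
  | prime_mul q m hq ih =>
    obtain ⟨h1, h2⟩ := ih (right_ne_zero_of_mul hn)
    obtain ⟨r, rfl⟩ : ∃ r : Nat.Primes, (r : ℕ) = q := ⟨⟨q, hq⟩, rfl⟩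
    have h3 : (Function.mulSupport fun p : Nat.Primes ↦ ‖((r : ℕ) : ℚ_[(p : ℕ)])‖).Finite := by
      refine (Set.finite_singleton r).subset fun p hp ↦ ?_
      by_contra h
      exact hp ((norm_natCast_prime p r).trans (if_neg h))
    simp only [Nat.cast_mul, norm_mul]
    refine ⟨(h3.union h1).subset (Function.mulSupport_mul _ _), ?_⟩
    rw [finprod_mul_distrib h3 h1, h2, mul_inv,
      finprod_eq_single _ r fun p hp ↦ (norm_natCast_prime p r).trans (if_neg hp),
      norm_natCast_prime, if_pos rfl]

/-- The finite ideles in `n·Ẑ^×`. -/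
def natCoset (n : ℕ+) : Set FiniteIdeles :=
  {x | ∀ p : Nat.Primes, ‖((x : IdeleComponents) p : ℚ_[(p : ℕ)])‖ = ‖((n : ℕ) : ℚ_[(p : ℕ)])‖}

theorem natCoset_one : natCoset 1 = zHatUnits := by
  simp [natCoset, zHatUnits]

theorem fnorm_of_mem_natCoset {n : ℕ+} {x : FiniteIdeles} (hx : x ∈ natCoset n) :
    fnorm x = ((n : ℕ) : ℝ)⁻¹ := by
  rw [fnorm, finprod_congr hx]
  exact (finprod_norm_natCast n.ne_zero).2

theorem pairwise_disjoint_natCoset : Pairwise (Function.onFun Disjoint natCoset) := by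
  intro m n hmn
  refine Set.disjoint_left.mpr fun x hm hn ↦ hmn ?_
  have := (fnorm_of_mem_natCoset hm).symm.trans (fnorm_of_mem_natCoset hn)
  rw [inv_inj] at this
  exact PNat.coe_injective (by exact_mod_cast this)

theorem exists_mem_natCoset {x : FiniteIdeles} (hx : IsIntegralIdele x) : ∃ n, x ∈ natCoset n := by
  have hfin : {p : Nat.Primes | ‖((x : IdeleComponents) p : ℚ_[(p : ℕ)])‖ ≠ 1}.Finite := x.2
  let v : Nat.Primes → ℕ := fun p ↦ ((x : IdeleComponents) p : ℚ_[(p : ℕ)]).valuation.toNat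
  have hv : ∀ p : Nat.Primes, ‖((x : IdeleComponents) p : ℚ_[(p : ℕ)])‖ =
      (((p : ℕ) : ℝ)⁻¹) ^ v p := by
    intro p
    have h0 : ((x : IdeleComponents) p : ℚ_[(p : ℕ)]) ≠ 0 := Units.ne_zero _
    have h1 : 0 ≤ ((x : IdeleComponents) p : ℚ_[(p : ℕ)]).valuation := by
      exact Padic.norm_le_one_iff_val_nonneg _ |>.mp (hx p)
    rw [Padic.norm_eq_zpow_neg_valuation h0, zpow_neg, inv_pow, ← zpow_natCast,
      Int.toNat_of_nonneg h1]
  refine ⟨⟨∏ p ∈ hfin.toFinset, (p : ℕ) ^ v p, Finset.prod_pos fun p _ ↦ pow_pos p.2.pos _⟩,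
    fun q ↦ ?_⟩
  simp only [PNat.mk_coe, Nat.cast_prod, Nat.cast_pow, norm_prod, norm_pow, norm_natCast_prime,
    ite_pow, one_pow, Finset.prod_ite_eq, Set.Finite.mem_toFinset, Set.mem_ofPred_eq]
  split_ifs with h
  · exact hv q
  · exact not_not.mp h

/-- The principal idele of a positive integer. -/
def principalIdele (n : ℕ+) : Ideles :=
  (Units.mk0 ((n : ℕ) : ℝ) (by simp),
    ⟨fun _ ↦ Units.mk0 ((n : ℕ) : ℚ_[_]) (by simp), (finprod_norm_natCast n.ne_zero).1⟩)

theorem principalIdele_mul_mem_iff {n : ℕ+} {x : Ideles} :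
    (principalIdele n * x).2 ∈ natCoset n ↔ x.2 ∈ zHatUnits := by
  refine forall_congr' fun p ↦ ?_
  simp [principalIdele]

theorem inorm_of_mem_zHatUnits {x : Ideles} (hx : x.2 ∈ zHatUnits) : inorm x = |(x.1 : ℝ)| := by
  rw [← natCoset_one] at hx
  simp [inorm, fnorm_of_mem_natCoset hx]

theorem inorm_principalIdele_mul {n : ℕ+} {x : Ideles} (hx : x.2 ∈ zHatUnits) :
    inorm (principalIdele n * x) = inorm x := by
  rw [inorm_of_mem_zHatUnits hx, inorm,
    fnorm_of_mem_natCoset (principalIdele_mul_mem_iff.mpr hx)]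
  have : ((n : ℕ) : ℝ) ≠ 0 := by simp
  simp only [principalIdele, Prod.fst_mul, Units.val_mul, Units.val_mk0, abs_mul, Nat.abs_cast]
  field_simp

theorem map_exp_volume : Measure.map Real.exp volume = positiveHaar := by
  ext s hs
  have himg : Real.exp '' (Real.exp ⁻¹' s) = s ∩ Set.Ioi 0 := by
    rw [Set.image_preimage_eq_inter_range, Real.range_exp]
  have h := lintegral_image_eq_lintegral_abs_deriv_mul (Real.measurable_exp hs)
    (fun x _ ↦ (Real.hasDerivAt_exp x).hasDerivWithinAt) Real.exp_injective.injOn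
    fun t ↦ ENNReal.ofReal t⁻¹
  rw [himg] at h
  rw [Measure.map_apply Real.measurable_exp hs, positiveHaar, withDensity_apply _ hs,
    Measure.restrict_restrict hs, h]
  have (x : ℝ) : ENNReal.ofReal |Real.exp x| * ENNReal.ofReal (Real.exp x)⁻¹ = 1 := by
    rw [← ENNReal.ofReal_mul (abs_nonneg _), abs_of_pos (Real.exp_pos x),
      mul_inv_cancel₀ (Real.exp_pos x).ne', ENNReal.ofReal_one]
  simp only [this, lintegral_one, Measure.restrict_apply_univ]

theorem eq_two_smul_volume {ρ : Measure ℝ} (hρ : ∀ c, Measure.map (c + ·) ρ = ρ)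
    (h : ρ (Set.Icc 0 1) = 2) : ρ = (2 : NNReal) • volume := by
  have : ρ.IsAddLeftInvariant := ⟨hρ⟩
  have : IsFiniteMeasureOnCompacts ρ := ⟨fun K hK ↦
    measure_lt_top_of_isCompact_of_isAddLeftInvariant' (U := Set.Icc 0 1) (by simp) (by simp [h])
      hK⟩
  have key := Measure.isAddLeftInvariant_eq_smul ρ volume
  have h' := h
  rw [key] at h'
  have hs : Measure.addHaarScalarFactor ρ volume = 2 := by
    rw [Measure.smul_apply, Real.volume_Icc, sub_zero, ENNReal.ofReal_one, ENNReal.smul_def,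
      smul_eq_mul, mul_one] at h'
    exact_mod_cast h'
  rwa [hs] at key

theorem map_prodMk_restrict_iUnion {X : Type*} [MeasurableSpace X] {μ : Measure X} {E : ℕ+ → Set X}
    (hE : ∀ n, MeasurableSet (E n)) (hd : Pairwise (Function.onFun Disjoint E))
    {i : X → ℕ+} (hi : Measurable i) (hiE : ∀ n, ∀ x ∈ E n, i x = n) {h : X → ℝ}
    (hh : Measurable h) {ν : Measure ℝ} [SFinite ν]
    (hν : ∀ n, Measure.map h (μ.restrict (E n)) = ν) :
    Measure.map (fun x ↦ (i x, h x)) (μ.restrict (⋃ n, E n)) =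
      (Measure.count : Measure ℕ+).prod ν := by
  rw [Measure.restrict_iUnion hd hE, Measure.map_sum (by fun_prop), Measure.count,
    Measure.prod_sum_left]
  congr 1 with n : 1
  rw [Measure.dirac_prod, ← hν n, Measure.map_map (by fun_prop) hh]
  refine Measure.map_congr ?_
  filter_upwards [ae_restrict_mem (hE n)] with x hx
  simp [hiE n x hx]

theorem setIntegral_prod_eq_of_map {X Y : Type*} [MeasurableSpace X] [MeasurableSpace Y]
    {μ : Measure X} [SFinite μ] {S : Set X} (hS : MeasurableSet S) {Φ : X → Y} (hΦ : Measurable Φ)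
    {T : Set (Y × Y)} (hT : MeasurableSet T) {f g : X → ℂ} {A B : Y → ℂ} (hA : Measurable A)
    (hB : Measurable B) (hfA : ∀ x ∈ S, f x = A (Φ x)) (hf0 : ∀ x ∉ S, f x = 0)
    (hgB : ∀ x ∈ S, g x = B (Φ x)) (hg0 : ∀ x ∉ S, g x = 0) :
    ∫ z in {q : X × X | (Φ q.1, Φ q.2) ∈ T}, f z.1 * g z.2 ∂(μ.prod μ) =
      ∫ q in T, A q.1 * B q.2 ∂((Measure.map Φ (μ.restrict S)).prod
        (Measure.map Φ (μ.restrict S))) := by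
  have hT' : MeasurableSet {q : X × X | (Φ q.1, Φ q.2) ∈ T} :=
    (show Measurable fun q : X × X ↦ (Φ q.1, Φ q.2) by fun_prop) hT
  rw [Measure.map_prod_map _ _ hΦ hΦ, setIntegral_map hT (by fun_prop) (by fun_prop),
    Measure.prod_restrict, Measure.restrict_restrict (hT.preimage (hΦ.prodMap hΦ))]
  symm
  rw [← integral_indicator ((hT.preimage (hΦ.prodMap hΦ)).inter (hS.prod hS)),
    ← integral_indicator hT']
  congr with z
  by_cases hz : (Φ z.1, Φ z.2) ∈ T
  · by_cases h1 : z.1 ∈ S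
    · by_cases h2 : z.2 ∈ S
      · simp [Set.indicator, Prod.map, hz, h1, h2, hfA, hgB]
      · simp [Set.indicator, h2, hg0]
    · simp [Set.indicator, h1, hf0]
  · simp [Set.indicator, Prod.map, hz]

/-- The index `n` of the coset `n·Ẑ^×` containing a finite idele, with junk value `1` on
non-integral ideles. -/
def cosetIndex (x : FiniteIdeles) : ℕ+ :=
  open Classical in if h : ∃ n, x ∈ natCoset n then h.choose else 1

theorem cosetIndex_of_mem {n : ℕ+} {x : FiniteIdeles} (hx : x ∈ natCoset n) :
    cosetIndex x = n := by
  have h : ∃ n, x ∈ natCoset n := ⟨n, hx⟩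
  rw [cosetIndex, dif_pos h]
  by_contra hne
  exact Set.disjoint_left.mp (pairwise_disjoint_natCoset hne) h.choose_spec hx

theorem eq_mellinTerm {a : ℕ+ → ℂ} {f : Ideles → ℂ} (hf : ∀ (n : ℕ+) (x : Ideles),
      (∀ p : Nat.Primes, ‖((x.2 : IdeleComponents) p : ℚ_[(p : ℕ)])‖
        = ‖((n : ℕ) : ℚ_[(p : ℕ)])‖) →
      f x = a n * Real.exp (-(2 * Real.pi * |(x.1 : ℝ)|))) (s : ℂ) {x : Ideles}
    (hx : x ∈ ⋃ n, (Prod.snd ⁻¹' natCoset n : Set Ideles)) :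
    f x * (inorm x : ℂ) ^ s = mellinTerm a s (cosetIndex x.2, inorm x) := by
  obtain ⟨n, hn⟩ := Set.mem_iUnion.mp hx
  have hn' : x.2 ∈ natCoset n := hn
  have : (n : ℝ) * inorm x = |(x.1 : ℝ)| := by
    rw [inorm, fnorm_of_mem_natCoset hn']
    have : ((n : ℕ) : ℝ) ≠ 0 := by simp
    field_simp
  rw [mellinTerm, cosetIndex_of_mem hn', hf n x hn']
  simp only [this]

section IdeleMeasure

variable [MeasurableSpace ℝˣ] [MeasurableSpace FiniteIdeles] {μ : Measure Ideles}

theorem measurableSet_preimage_natCoset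
    (hinv : ∀ x : Ideles, MeasurePreserving (fun y => x * y) μ μ)
    (hZmeas : MeasurableSet zHatUnits) (n : ℕ+) :
    MeasurableSet (Prod.snd ⁻¹' natCoset n : Set Ideles) := by
  convert! (hinv (principalIdele n)⁻¹).measurable (measurable_snd hZmeas) using 1
  ext x
  simp only [Set.mem_preimage]
  rw [← principalIdele_mul_mem_iff (n := n), mul_inv_cancel_left]

theorem measurable_cosetIndex (hinv : ∀ x : Ideles, MeasurePreserving (fun y => x * y) μ μ)
    (hZmeas : MeasurableSet zHatUnits) : Measurable fun x : Ideles ↦ cosetIndex x.2 := by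
  have hE := measurableSet_preimage_natCoset hinv hZmeas
  refine measurable_to_countable' fun n ↦ ?_
  by_cases hn : n = 1
  · convert! (hE n).union (MeasurableSet.iUnion hE).compl using 1
    ext x
    simp only [Set.mem_preimage, Set.mem_singleton_iff, Set.mem_union, Set.mem_compl_iff,
      Set.mem_iUnion]
    constructor
    · intro h
      by_contra! hx
      obtain ⟨hx, m, hm⟩ := hx
      rw [cosetIndex_of_mem hm] at h
      exact hx (h ▸ hm)
    · rintro (h | h)
      · exact cosetIndex_of_mem h
      · rw [cosetIndex, dif_neg h, hn]
  · convert! hE n using 1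
    ext x
    simp only [Set.mem_preimage, Set.mem_singleton_iff]
    refine ⟨fun h ↦ ?_, cosetIndex_of_mem⟩
    by_cases hx : ∃ m, x.2 ∈ natCoset m
    · obtain ⟨m, hm⟩ := hx
      rw [cosetIndex_of_mem hm] at h
      exact h ▸ hm
    · rw [cosetIndex, dif_neg hx] at h
      exact absurd h.symm hn

theorem map_mul_restrict_zHatUnits (hinv : ∀ x : Ideles, MeasurePreserving (fun y => x * y) μ μ)
    (hZmeas : MeasurableSet zHatUnits) (u : ℝˣ) :
    Measure.map (fun y ↦ ((u, 1) : Ideles) * y) (μ.restrict (Prod.snd ⁻¹' zHatUnits)) =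
      μ.restrict (Prod.snd ⁻¹' zHatUnits) := by
  convert! ((hinv (u, 1)).restrict_preimage (measurable_snd hZmeas)).map_eq using 3
  ext x
  simp

variable [BorelSpace ℝˣ]

theorem measurable_inorm (hnorm : Measurable fnorm) : Measurable inorm := by
  have h : Measurable fun u : ℝˣ ↦ (u : ℝ) := Units.continuous_val.measurable
  unfold inorm
  fun_prop

theorem map_log_abs_restrict_zHatUnits
    (hinv : ∀ x : Ideles, MeasurePreserving (fun y => x * y) μ μ)
    (hZmeas : MeasurableSet zHatUnits)
    (hB : μ {x : Ideles | 1 ≤ (x.1 : ℝ) ∧ (x.1 : ℝ) ≤ Real.exp 1 ∧ x.2 ∈ zHatUnits} = 1) :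
    Measure.map (fun x : Ideles ↦ Real.log |(x.1 : ℝ)|) (μ.restrict (Prod.snd ⁻¹' zHatUnits)) =
      (2 : NNReal) • volume := by
  have hval : Measurable fun u : ℝˣ ↦ (u : ℝ) := Units.continuous_val.measurable
  have hlog : Measurable fun x : Ideles ↦ Real.log |(x.1 : ℝ)| := by fun_prop
  refine eq_two_smul_volume (fun c ↦ ?_) ?_
  · rw [Measure.map_map (by fun_prop) hlog]
    conv_rhs => rw [← map_mul_restrict_zHatUnits hinv hZmeas (Units.mk0 _ (Real.exp_ne_zero c)),
      Measure.map_map hlog (hinv _).measurable]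
    congr 1 with x
    simp [Real.log_mul]
  · rw [Measure.map_apply hlog measurableSet_Icc, Measure.restrict_apply (hlog measurableSet_Icc)]
    set P : Set Ideles := {x | 1 ≤ (x.1 : ℝ) ∧ (x.1 : ℝ) ≤ Real.exp 1 ∧ x.2 ∈ zHatUnits}
    have hP : MeasurableSet P := by
      have hfst : Measurable fun x : Ideles ↦ (x.1 : ℝ) := by fun_prop
      exact (measurableSet_le measurable_const hfst).inter
        ((measurableSet_le hfst measurable_const).inter (measurable_snd hZmeas))
    have hN : μ ((fun y ↦ ((-1, 1) : Ideles) * y) ⁻¹' P) = 1 := by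
      rw [(hinv _).measure_preimage hP.nullMeasurableSet, hB]
    have hset : (fun x : Ideles ↦ Real.log |(x.1 : ℝ)|) ⁻¹' Set.Icc 0 1 ∩ Prod.snd ⁻¹' zHatUnits =
        P ∪ (fun y ↦ ((-1, 1) : Ideles) * y) ⁻¹' P := by
      ext x
      have hx : 0 < |(x.1 : ℝ)| := by simp
      simp only [P, Set.mem_inter_iff, Set.mem_preimage, Set.mem_Icc, Set.mem_union,
        Set.mem_ofPred_eq, Real.log_nonneg_iff hx, Real.log_le_iff_le_exp hx, Prod.fst_mul,
        Prod.snd_mul, one_mul, Units.val_neg, neg_mul]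
      rcases abs_cases (x.1 : ℝ) with h | h <;> grind
    rw [hset, measure_union _ ((hinv _).measurable hP), hB, hN, one_add_one_eq_two]
    refine Set.disjoint_left.mpr fun x h1 h2 ↦ ?_
    have h3 := h1.1
    have h4 := h2.1
    simp at h4
    linarith

theorem map_inorm_restrict_natCoset
    (hinv : ∀ x : Ideles, MeasurePreserving (fun y => x * y) μ μ)
    (hnorm : Measurable fnorm) (hZmeas : MeasurableSet zHatUnits)
    (hB : μ {x : Ideles | 1 ≤ (x.1 : ℝ) ∧ (x.1 : ℝ) ≤ Real.exp 1 ∧ x.2 ∈ zHatUnits} = 1)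
    (n : ℕ+) :
    Measure.map inorm (μ.restrict (Prod.snd ⁻¹' natCoset n)) = (2 : NNReal) • positiveHaar := by
  have hval : Measurable fun u : ℝˣ ↦ (u : ℝ) := Units.continuous_val.measurable
  have hpre : (fun y ↦ principalIdele n * y) ⁻¹' (Prod.snd ⁻¹' natCoset n) =
      Prod.snd ⁻¹' zHatUnits := by
    ext x
    exact principalIdele_mul_mem_iff
  have hmp := (hinv (principalIdele n)).restrict_preimage
    (measurableSet_preimage_natCoset hinv hZmeas n)
  rw [hpre] at hmp
  rw [← hmp.map_eq, Measure.map_map (measurable_inorm hnorm) hmp.measurable, ← map_exp_volume,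
    ← Measure.map_smul, ← map_log_abs_restrict_zHatUnits hinv hZmeas hB,
    Measure.map_map Real.measurable_exp (by fun_prop)]
  refine Measure.map_congr ?_
  filter_upwards [ae_restrict_mem (measurable_snd hZmeas)] with x hx
  simp only [Function.comp_apply]
  rw [inorm_principalIdele_mul hx, inorm_of_mem_zHatUnits hx, Real.exp_log (by simp)]

theorem setIntegral_inorm_lt [SFinite μ]
    (hinv : ∀ x : Ideles, MeasurePreserving (fun y => x * y) μ μ)
    (hnorm : Measurable fnorm) (hZmeas : MeasurableSet zHatUnits)
    (hB : μ {x : Ideles | 1 ≤ (x.1 : ℝ) ∧ (x.1 : ℝ) ≤ Real.exp 1 ∧ x.2 ∈ zHatUnits} = 1)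
    {a b : ℕ+ → ℂ} {f g : Ideles → ℂ}
    (hf : ∀ (n : ℕ+) (x : Ideles),
      (∀ p : Nat.Primes, ‖((x.2 : IdeleComponents) p : ℚ_[(p : ℕ)])‖
        = ‖((n : ℕ) : ℚ_[(p : ℕ)])‖) →
      f x = a n * Real.exp (-(2 * Real.pi * |(x.1 : ℝ)|)))
    (hf0 : ∀ x : Ideles, ¬ IsIntegralIdele x.2 → f x = 0)
    (hg : ∀ (n : ℕ+) (x : Ideles),
      (∀ p : Nat.Primes, ‖((x.2 : IdeleComponents) p : ℚ_[(p : ℕ)])‖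
        = ‖((n : ℕ) : ℚ_[(p : ℕ)])‖) →
      g x = b n * Real.exp (-(2 * Real.pi * |(x.1 : ℝ)|)))
    (hg0 : ∀ x : Ideles, ¬ IsIntegralIdele x.2 → g x = 0)
    (s₁ s₂ : ℂ) :
    ∫ z in {q : Ideles × Ideles | inorm q.2 < inorm q.1},
      f z.1 * (inorm z.1 : ℂ) ^ s₁ * g z.2 * (inorm z.2 : ℂ) ^ s₂ ∂(μ.prod μ) =
    4 * ∫ q in {q : (ℕ+ × ℝ) × (ℕ+ × ℝ) | q.2.2 < q.1.2},
      mellinTerm a s₁ q.1 * mellinTerm b s₂ q.2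
      ∂(((Measure.count : Measure ℕ+).prod positiveHaar).prod
        ((Measure.count : Measure ℕ+).prod positiveHaar)) := by
  have hE := measurableSet_preimage_natCoset hinv hZmeas
  have hΦ : Measurable fun x : Ideles ↦ (cosetIndex x.2, inorm x) :=
    (measurable_cosetIndex hinv hZmeas).prodMk (measurable_inorm hnorm)
  have hmap := map_prodMk_restrict_iUnion hE
    (fun m n hmn ↦ (pairwise_disjoint_natCoset hmn).preimage _)
    (measurable_cosetIndex hinv hZmeas) (fun n x hx ↦ cosetIndex_of_mem hx)
    (measurable_inorm hnorm) (map_inorm_restrict_natCoset hinv hnorm hZmeas hB)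
  have hoff : ∀ x ∉ ⋃ n, (Prod.snd ⁻¹' natCoset n : Set Ideles), ¬ IsIntegralIdele x.2 :=
    fun x hx hint ↦ hx (Set.mem_iUnion.mpr (exists_mem_natCoset hint))
  have key := setIntegral_prod_eq_of_map (μ := μ) (MeasurableSet.iUnion hE) hΦ
    measurableSet_snd_lt_snd (measurable_mellinTerm a s₁) (measurable_mellinTerm b s₂)
    (f := fun x ↦ f x * (inorm x : ℂ) ^ s₁) (g := fun x ↦ g x * (inorm x : ℂ) ^ s₂)
    (fun x hx ↦ eq_mellinTerm hf s₁ hx) (fun x hx ↦ by simp [hf0 x (hoff x hx)])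
    (fun x hx ↦ eq_mellinTerm hg s₂ hx) (fun x hx ↦ by simp [hg0 x (hoff x hx)])
  simp only [← mul_assoc] at key
  refine key.trans ?_
  rw [hmap, Measure.prod_smul_right, Measure.prod_smul_left, Measure.prod_smul_right,
    Measure.restrict_smul, Measure.restrict_smul, integral_smul_nnreal_measure,
    integral_smul_nnreal_measure, smul_smul, NNReal.smul_def]
  norm_num

end IdeleMeasure

theorem tsum_mellinTerm {F : UpperHalfPlane → ℂ} {a : ℕ+ → ℂ}
    (hFa : ∀ z : UpperHalfPlane, F z =
      ∑' n : ℕ+, a n * Complex.exp (2 * Real.pi * Complex.I * (n : ℕ) * (z : ℂ)))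
    (s : ℂ) {t : ℝ} (ht : 0 < t) :
    (t : ℂ)⁻¹ * ∑' n, mellinTerm a s (n, t) = onImAxis F t * (t : ℂ) ^ (s - 1) := by
  rw [onImAxis, dif_pos ht, hFa, Complex.cpow_sub _ _ (by exact_mod_cast ht.ne'), Complex.cpow_one]
  simp only [mellinTerm, tsum_mul_right]
  rw [mul_div_assoc', mul_comm, ← div_eq_mul_inv]
  congr! 4 with n
  rw [Complex.ofReal_exp]
  congr 2
  push_cast
  linear_combination (-2 * Real.pi * n * t : ℂ) * Complex.I_mul_I

/-- Let `F, G` be cusp forms of even positive weights `k, l` for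
`SL₂(ℤ)` with Fourier coefficients `(a_n), (b_n)`, and define `f, g` on the idele
group `𝔸^× = ℝˣ × 𝔸_f^×` by `f(x) = a_n e^{-2π|x_∞|}` when the finite part of `x`
lies in `n·Ẑ^×` and `f(x) = 0` when it is not integral (similarly for `g` with
`b_n`).  Let `μ` be a translation-invariant (Haar) measure on `𝔸^×` normalized by
`μ({x | 1 ≤ x_∞ ≤ e, x_p ∈ ℤ_p^× ∀p}) = 1` (with `Ẑ^×` and the finite idele norm
measurable, as for a Borel measure).  For `Re s₁ > k`, `Re s₂ > l`, the iterated
adelic integral of `f(x₁)|x₁|^{s₁} g(x₂)|x₂|^{s₂}` over `|x₁| > |x₂|` equals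
`4 ∫∫_{t₁>t₂>0} F(it₁) G(it₂) t₁^{s₁-1} t₂^{s₂-1} dt₁ dt₂`, i.e. `4` times Manin's
completed iterated `L`-function `Λ(F,G,s₁,s₂)`. -/
theorem adelic_iterated_completed_L_function (k l : ℤ) (hk : Even k) (hk0 : 0 < k)
    (hl : Even l) (hl0 : 0 < l)
    (F : CuspForm (CongruenceSubgroup.Gamma 1) k)
    (G : CuspForm (CongruenceSubgroup.Gamma 1) l)
    (a b : ℕ+ → ℂ)
    (hFa : ∀ z : UpperHalfPlane, F z =
      ∑' n : ℕ+, a n * Complex.exp (2 * Real.pi * Complex.I * (n : ℕ) * (z : ℂ)))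
    (hGb : ∀ z : UpperHalfPlane, G z =
      ∑' n : ℕ+, b n * Complex.exp (2 * Real.pi * Complex.I * (n : ℕ) * (z : ℂ)))
    [MeasurableSpace ℝˣ] [BorelSpace ℝˣ] [MeasurableSpace FiniteIdeles]
    (μ : Measure Ideles) [SFinite μ]
    (hinv : ∀ x : Ideles, MeasurePreserving (fun y => x * y) μ μ)
    (hnorm : Measurable fnorm) (hZmeas : MeasurableSet zHatUnits)
    (hB : μ {x : Ideles | 1 ≤ (x.1 : ℝ) ∧ (x.1 : ℝ) ≤ Real.exp 1 ∧ x.2 ∈ zHatUnits} = 1)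
    (f g : Ideles → ℂ)
    (hf : ∀ (n : ℕ+) (x : Ideles),
      (∀ p : Nat.Primes, ‖((x.2 : IdeleComponents) p : ℚ_[(p : ℕ)])‖
        = ‖((n : ℕ) : ℚ_[(p : ℕ)])‖) →
      f x = a n * Real.exp (-(2 * Real.pi * |(x.1 : ℝ)|)))
    (hf0 : ∀ x : Ideles, ¬ IsIntegralIdele x.2 → f x = 0)
    (hg : ∀ (n : ℕ+) (x : Ideles),
      (∀ p : Nat.Primes, ‖((x.2 : IdeleComponents) p : ℚ_[(p : ℕ)])‖
        = ‖((n : ℕ) : ℚ_[(p : ℕ)])‖) →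
      g x = b n * Real.exp (-(2 * Real.pi * |(x.1 : ℝ)|)))
    (hg0 : ∀ x : Ideles, ¬ IsIntegralIdele x.2 → g x = 0)
    (s₁ s₂ : ℂ) (h₁ : (k : ℝ) < s₁.re) (h₂ : (l : ℝ) < s₂.re) :
    ∫ z in {q : Ideles × Ideles | inorm q.2 < inorm q.1},
      f z.1 * (inorm z.1 : ℂ) ^ s₁ * g z.2 * (inorm z.2 : ℂ) ^ s₂ ∂(μ.prod μ)
      = 4 * ∫ t in {q : ℝ × ℝ | q.2 < q.1 ∧ 0 < q.2},
          onImAxis F t.1 * onImAxis G t.2 *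
            (t.1 : ℂ) ^ (s₁ - 1) * (t.2 : ℂ) ^ (s₂ - 1) := by
  have half : ∀ {w : ℤ} {s : ℂ}, Even w → 0 < w → (w : ℝ) < s.re →
      0 ≤ (w : ℝ) / 2 ∧ (w : ℝ) / 2 + 1 < s.re := by
    intro w s hw hw0 hws
    have : (2 : ℤ) ≤ w := by
      obtain ⟨r, rfl⟩ := hw
      lia
    have : (2 : ℝ) ≤ w := by exact_mod_cast this
    constructor <;> linarith
  rw [setIntegral_inorm_lt hinv hnorm hZmeas hB hf hf0 hg hg0,
    setIntegral_mellinTerm (cuspForm_coeff_dichotomy F a hFa) (half hk hk0 h₁).1 (half hk hk0 h₁).2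
      (cuspForm_coeff_dichotomy G b hGb) (half hl hl0 h₂).1 (half hl hl0 h₂).2,
    setIntegral_positiveHaar_prod]
  congr 1
  have hm : MeasurableSet {q : ℝ × ℝ | q.2 < q.1 ∧ 0 < q.2} :=
    (measurableSet_lt measurable_snd measurable_fst).inter
      (measurableSet_lt measurable_const measurable_snd)
  refine setIntegral_congr_fun hm fun q hq ↦ ?_
  have hF := tsum_mellinTerm hFa s₁ (hq.2.trans hq.1)
  have hG := tsum_mellinTerm hGb s₂ hq.2
  calc _ = ((q.1 : ℂ)⁻¹ * ∑' n, mellinTerm a s₁ (n, q.1)) *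
        ((q.2 : ℂ)⁻¹ * ∑' m, mellinTerm b s₂ (m, q.2)) := by ring
    _ = _ := by
      rw [hF, hG]
      ring

end
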